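/- For any ν > 0 and k ∈ ℕ, the integral 𝒥_{ν,k}(X) = ∫_0^X (X² - u²)^((k-2)/2) J_ν(2πu) u^(ν+1) du satisfies the bound 𝒥_{ν,k}(X) = O_{ν,k}(X^((k+2ν-1)/2)) as X → ∞. -/

import Mathlib

open Real Filter Asymptotics

/-- The Bessel function of the first kind of order `ν`, defined by its power series. -/
noncomputable def besselJ (ν : ℝ) (x : ℝ) : ℝ :=
  ∑' m : ℕ, ((-1 : ℝ)^m / (m.factorial * Real.Gamma (m + ν + 1))) * (x/2) ^ (2*(m:ℝ) + ν)

/-- The oscillatory integral `𝒥_{ν,k}(X)`. -/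
noncomputable def Jcal (ν : ℝ) (k : ℕ) (X : ℝ) : ℝ :=
  ∫ u in (0:ℝ)..X, (X^2 - u^2) ^ (((k:ℝ) - 2)/2) * besselJ ν (2*Real.pi*u) * u ^ (ν+1)

theorem Gamma_ge (α : ℝ) (hα : 0 < α) (m : ℕ) : Real.Gamma (α+1) ≤ Real.Gamma (m + α + 1) := by
  induction m with
  | zero => simp
  | succ n ih =>
    refine ih.trans ?_
    have h : ((n+1:ℕ):ℝ) + α + 1 = (n + α + 1) + 1 := by push_cast; ring
    rw [h, Real.Gamma_add_one (s := n + α + 1) (by positivity)]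
    have : 0 < Real.Gamma (n + α + 1) := Real.Gamma_pos_of_pos (by positivity)
    have h0 : (0:ℝ) ≤ n := by positivity
    nlinarith

noncomputable def cf (α : ℝ) (m : ℕ) : ℝ := (-1 : ℝ)^m / (m.factorial * Real.Gamma (m + α + 1))
noncomputable def Phi (α t : ℝ) : ℝ := ∑' m : ℕ, cf α m * t ^ m

theorem cf_bound (α : ℝ) (hα : 0 < α) (m : ℕ) :
    |cf α m| ≤ (Real.Gamma (α+1))⁻¹ * (1 / m.factorial) := by
  have h1 := Gamma_ge α hα m
  have h0 : 0 < Real.Gamma (α+1) := Real.Gamma_pos_of_pos (by positivity)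
  have hG : 0 < Real.Gamma (m + α + 1) := Real.Gamma_pos_of_pos (by positivity)
  have hf : (0:ℝ) < m.factorial := by positivity
  unfold cf
  rw [abs_div, abs_pow, abs_neg, abs_one, one_pow, abs_of_pos (by positivity), one_div, mul_inv, one_div, mul_comm]
  gcongr

theorem cf_sum (α : ℝ) (hα : 0 < α) (t : ℝ) : Summable (fun m => cf α m * t ^ m) := by
  refine Summable.of_norm_bounded
    (g := fun m : ℕ => (Real.Gamma (α+1))⁻¹ * (|t|^m / m.factorial))
    ((Real.summable_pow_div_factorial |t|).mul_left _) ?_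
  intro m
  rw [norm_mul, Real.norm_eq_abs, Real.norm_eq_abs, abs_pow]
  calc _ ≤ (Real.Gamma (α+1))⁻¹ * (1 / m.factorial) * |t|^m := by
        gcongr; exact cf_bound α hα m
    _ = _ := by ring

theorem cf_succ (α : ℝ) (m : ℕ) : cf α (m+1) * (m+1) = - cf (α+1) m := by
  unfold cf
  have h : ((m+1:ℕ):ℝ) + α + 1 = m + (α + 1) + 1 := by push_cast; ring
  rw [h, Nat.factorial_succ]
  push_cast
  have : (m:ℝ)+1 ≠ 0 := by positivity
  rw [pow_succ, div_mul_eq_mul_div, show (-1:ℝ)^m * -1 * (m+1) = (m+1) * (-(-1:ℝ)^m) by ring,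
    mul_assoc, mul_div_mul_left _ _ this, neg_div]

theorem cf_rec (α : ℝ) (hα : 0 < α) (m : ℕ) : cf α m = (m + α + 1) * cf (α+1) m := by
  unfold cf
  have hG : 0 < Real.Gamma (m + α + 1) := Real.Gamma_pos_of_pos (by positivity)
  have h : (m:ℝ) + (α + 1) + 1 = (m + α + 1) + 1 := by ring
  have h2 : (m:ℝ) + α + 1 ≠ 0 := by positivity
  rw [h, Real.Gamma_add_one h2]
  field_simp

theorem Phi_deriv (α : ℝ) (hα : 0 < α) (t : ℝ) : HasDerivAt (Phi α) (- Phi (α+1) t) t := by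
  set R := |t| + 1
  have hR : 0 ≤ R := by positivity
  have key := hasDerivAt_tsum_of_isPreconnected (𝕜 := ℝ) (F := ℝ)
    (g := fun (m:ℕ) y => cf α m * y ^ m)
    (g' := fun (m:ℕ) y => cf α m * (m * y^(m-1))) (t := Metric.ball (0:ℝ) R) (y₀ := 0) (y := t)
    (u := fun m : ℕ => (Real.Gamma (α+1))⁻¹ * (1 / m.factorial) * (m * R^(m-1))) ?_
    Metric.isOpen_ball (convex_ball _ _).isPreconnected ?_ ?_ ?_ (cf_sum α hα 0) ?_
  · refine key.congr_deriv ?_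
    have hs : Summable (fun m:ℕ => cf α m * (m * t^(m-1))) := by
      rw [← summable_nat_add_iff 1]
      refine (cf_sum (α+1) (by positivity) t).neg.congr fun m => ?_
      rw [← neg_mul, ← cf_succ]; push_cast; ring
    rw [hs.tsum_eq_zero_add]
    simp only [Nat.cast_zero, zero_mul, mul_zero, zero_add]
    unfold Phi
    rw [← tsum_neg]
    congr 1; ext m
    rw [← neg_mul, ← cf_succ]; push_cast; ring
  · rw [← summable_nat_add_iff 1]
    refine ((Real.summable_pow_div_factorial R).mul_left (Real.Gamma (α+1))⁻¹).congr fun m => ?_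
    rw [Nat.factorial_succ]; push_cast; field_simp
  · intro n y _
    exact (hasDerivAt_pow n y).const_mul _
  · intro n y hy
    rw [norm_mul, norm_mul, norm_pow, Real.norm_eq_abs]
    have : ‖y‖ ≤ R := by simpa using (Metric.mem_ball.1 hy).le
    gcongr
    · exact cf_bound α hα n
    · simp
  · simp; positivity
  · simp [R]

theorem Phi_rec (α : ℝ) (hα : 0 < α) (t : ℝ) :
    Phi α t = (α+1) * Phi (α+1) t - t * Phi (α+2) t := by
  have h1 := cf_sum (α+1) (by positivity) t
  have h2 := cf_sum (α+1+1) (by positivity) t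
  have h3 : Summable (fun m:ℕ => cf (α+1) m * m * t^m) := by
    rw [← summable_nat_add_iff 1]
    refine (h2.mul_left (-t)).congr fun m => ?_
    have := cf_succ (α+1) m
    push_cast
    rw [this]; ring
  have h4 : ∑' m:ℕ, cf (α+1) m * m * t^m = - t * Phi (α+2) t := by
    rw [h3.tsum_eq_zero_add]
    unfold Phi
    rw [← tsum_mul_left]
    simp only [Nat.cast_zero, mul_zero, zero_mul, zero_add]
    congr 1; ext m
    have := cf_succ (α+1) m
    push_cast
    rw [this, show α+1+1 = α+2 by ring]; ring
  have : Phi α t = (α+1) * Phi (α+1) t + ∑' m:ℕ, cf (α+1) m * m * t^m := by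
    unfold Phi
    rw [← tsum_mul_left, ← (h1.mul_left _).tsum_add h3]
    congr 1; ext m
    rw [cf_rec α hα m]; ring
  rw [this, h4]; ring

noncomputable def PJ (α u : ℝ) : ℝ := besselJ α (2*Real.pi*u)

theorem PJ_eq (α : ℝ) (hα : 0 < α) (u : ℝ) (hu : 0 ≤ u) :
    PJ α u = (π * u) ^ α * Phi α ((π * u)^2) := by
  unfold PJ besselJ Phi
  rw [← tsum_mul_left]
  congr 1; ext m
  have : 2 * π * u / 2 = π * u := by ring
  have hp := Real.pi_pos
  rw [this, Real.rpow_add_of_nonneg (by positivity) (by positivity) hα.le,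
    show (2*(m:ℝ)) = ((2*m:ℕ):ℝ) by push_cast; ring, Real.rpow_natCast, pow_mul]
  unfold cf; ring

theorem PJ_cont (α : ℝ) (hα : 0 < α) : ContinuousOn (PJ α) (Set.Ici 0) := by
  have hc : Continuous (Phi α) := continuous_iff_continuousAt.2 fun t => (Phi_deriv α hα t).continuousAt
  have : Continuous (fun u => (π * u) ^ α * Phi α ((π * u)^2)) := by
    refine Continuous.mul ?_ (by fun_prop)
    exact Continuous.rpow_const (by fun_prop) (fun _ => Or.inr hα.le)
  exact this.continuousOn.congr fun u hu => PJ_eq α hα u hu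

theorem PJ_deriv_down (α : ℝ) (hα : 0 < α) (u : ℝ) (hu : 0 < u) :
    HasDerivAt (PJ α) (α / u * PJ α u - 2 * π * PJ (α+1) u) u := by
  have hp := Real.pi_pos
  have h1 : HasDerivAt (fun u => π * u) π u := by simpa using (hasDerivAt_id u).const_mul π
  have h2 := h1.rpow_const (p := α) (Or.inl (by positivity))
  have h3 := (Phi_deriv α hα ((π*u)^2)).comp u (h1.pow 2)
  have h4 := h2.mul h3
  refine (h4.congr_of_eventuallyEq ?_).congr_deriv ?_
  · filter_upwards [lt_mem_nhds hu] with v hv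
    rw [PJ_eq α hα v hv.le]; rfl
  · rw [PJ_eq α hα u hu.le, PJ_eq (α+1) (by positivity) u hu.le, Real.rpow_sub_one (by positivity),
      Real.rpow_add_one (by positivity)]
    simp only [Function.comp, Pi.pow_apply]
    field_simp
    push_cast
    ring

theorem PJ_deriv_up (α : ℝ) (hα : 0 < α) (u : ℝ) (hu : 0 < u) :
    HasDerivAt (PJ (α+1)) (2 * π * PJ α u - (α+1) / u * PJ (α+1) u) u := by
  refine (PJ_deriv_down (α+1) (by positivity) u hu).congr_deriv ?_
  have hp := Real.pi_pos
  rw [PJ_eq α hα u hu.le, PJ_eq (α+1) (by positivity) u hu.le, PJ_eq (α+1+1) (by positivity) u hu.le,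
    Phi_rec α hα, Real.rpow_add_one (x := π * u) (by positivity) (α+1),
      Real.rpow_add_one (x := π * u) (by positivity) α, show α+1+1 = α+2 by ring]
  field_simp
  ring

theorem PJ_energy (α : ℝ) (hα : 0 < α) :
    ∃ C : ℝ, 0 < C ∧ ∀ u : ℝ, 0 < u → u * ((PJ α u)^2 + (PJ (α+1) u)^2) ≤ C := by
  have hp := Real.pi_pos
  obtain ⟨c, hc⟩ : ∃ c, c = (2*α+1)/(2*π) := ⟨_, rfl⟩
  have hc0 : 0 < c := by rw [hc]; positivity
  have hcpi : c * (2*π) = 2*α+1 := by rw [hc]; field_simp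
  set A := PJ α
  set B := PJ (α+1)
  have hcA : ContinuousOn A (Set.Ici 0) := PJ_cont α hα
  have hcB : ContinuousOn B (Set.Ici 0) := PJ_cont (α+1) (by positivity)
  set F : ℝ → ℝ := fun u => (u * (A u^2 + B u^2) - c * (A u * B u)) * Real.exp (c/u)
  have hE : ∀ u, c ≤ u → u/2 * (A u^2 + B u^2) ≤ u * (A u^2 + B u^2) - c * (A u * B u) := by
    intro u hu
    have h1 : A u * B u ≤ (A u^2 + B u^2)/2 := by nlinarith [sq_nonneg (A u - B u)]
    have h2 : 0 ≤ (A u^2 + B u^2)/2 := by positivity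
    nlinarith [mul_le_mul_of_nonneg_left h1 hc0.le, mul_le_mul_of_nonneg_right hu h2]
  have hF : ∀ u, 0 < u → HasDerivAt F ((c / u * (A u * B u) - c/u^2 * (u * (A u^2 + B u^2) - c * (A u * B u))) * Real.exp (c/u)) u := by
    intro u hu
    have hA : HasDerivAt A (α / u * A u - 2 * π * B u) u := PJ_deriv_down α hα u hu
    have hB : HasDerivAt B (2 * π * A u - (α+1) / u * B u) u := PJ_deriv_up α hα u hu
    have h1 := ((hasDerivAt_id u).mul ((hA.pow 2).add (hB.pow 2))).sub ((hA.mul hB).const_mul c)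
    have h2 := (((hasDerivAt_const u c).div (hasDerivAt_id u) hu.ne')).exp
    refine (h1.mul h2).congr_deriv ?_
    simp only [Pi.add_apply, Pi.pow_apply, Pi.mul_apply, Pi.sub_apply, Pi.div_apply, id]
    generalize Real.exp (c/u) = e
    have h3 : (2 * α + 1) * (A u ^2 - B u^2) = c * (2*π) * (A u ^2 - B u^2) := by rw [hcpi]
    push_cast
    field_simp
    linear_combination (e * u^2) * h3
  have hanti : AntitoneOn F (Set.Ici c) := by
    refine antitoneOn_of_deriv_nonpos (convex_Ici c) ?_ ?_ ?_
    · intro u hu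
      exact (hF u (hc0.trans_le hu)).continuousAt.continuousWithinAt
    · intro u hu
      rw [interior_Ici] at hu
      exact (hF u (hc0.trans hu)).differentiableAt.differentiableWithinAt
    · intro u hu
      rw [interior_Ici] at hu
      have hu' : c < u := hu
      have hu0 := hc0.trans hu'
      rw [(hF u hu0).deriv]
      refine mul_nonpos_of_nonpos_of_nonneg ?_ (Real.exp_pos _).le
      have h1 : A u * B u ≤ (A u^2 + B u^2)/2 := by nlinarith [sq_nonneg (A u - B u)]
      have h2 := hE u hu'.le
      have h3 : c / u * (A u * B u) ≤ c / u * ((A u^2 + B u^2)/2) := by gcongr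
      have h4 : c / u^2 * (u/2 * (A u^2 + B u^2)) ≤ c/u^2 * (u * (A u^2 + B u^2) - c * (A u * B u)) := by gcongr
      have h5 : c / u^2 * (u/2 * (A u^2 + B u^2)) = c / u * ((A u^2 + B u^2)/2) := by field_simp
      linarith
  obtain ⟨M, hM⟩ := (isCompact_Icc (a := (0:ℝ)) (b := c)).exists_bound_of_continuousOn
    (f := fun u => u * (A u^2 + B u^2)) (by
      have h1 := hcA.mono (fun x (hx : x ∈ Set.Icc 0 c) => Set.mem_Ici.2 hx.1)
      have h2 := hcB.mono (fun x (hx : x ∈ Set.Icc 0 c) => Set.mem_Ici.2 hx.1)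
      exact continuousOn_id.mul ((h1.pow 2).add (h2.pow 2)))
  refine ⟨max 1 (max M (2 * F c)), by positivity, fun u hu => ?_⟩
  rcases le_total u c with h | h
  · exact ((le_abs_self _).trans (hM u ⟨hu.le, h⟩)).trans ((le_max_left _ _).trans (le_max_right _ _))
  · refine le_trans ?_ ((le_max_right M (2 * F c)).trans (le_max_right _ _))
    have h1 := hanti (Set.mem_Ici.2 le_rfl) h h
    have h2 := hE u h
    have h3 : (1:ℝ) ≤ Real.exp (c/u) := Real.one_le_exp (by positivity)
    have h4 : 0 ≤ u/2 * (A u^2 + B u^2) := by positivity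
    have h5 : u * (A u^2 + B u^2) - c * (A u * B u) ≤ F u := le_mul_of_one_le_right (h4.trans h2) h3
    linarith

noncomputable def GJ (α u : ℝ) : ℝ := u ^ α * PJ α u

theorem GJ_bound (α : ℝ) (hα : 0 < α) :
    ∃ C : ℝ, 0 < C ∧ ∀ u : ℝ, 0 < u → |GJ α u| ≤ C * u ^ (α - 1/2) := by
  obtain ⟨C, hC, h⟩ := PJ_energy α hα
  refine ⟨√C, Real.sqrt_pos.2 hC, fun u hu => ?_⟩
  have h1 := h u hu
  have h2 : (PJ α u)^2 ≤ C / u := by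
    rw [le_div_iff₀ hu]; nlinarith [mul_nonneg hu.le (sq_nonneg (PJ (α+1) u))]
  have h3 := Real.abs_le_sqrt h2
  unfold GJ
  rw [abs_mul, abs_of_nonneg (by positivity), Real.rpow_sub hu, ← Real.sqrt_eq_rpow]
  rw [Real.sqrt_div hC.le] at h3
  calc _ ≤ u^α * (√C / √u) := by gcongr
    _ = _ := by ring

theorem GJ_bound' (α : ℝ) (hα : 0 < α) :
    ∃ C : ℝ, 0 < C ∧ ∀ u X : ℝ, 0 ≤ u → u ≤ X → |u * GJ α u| ≤ C * X ^ (α + 1/2) := by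
  obtain ⟨C, hC, h⟩ := GJ_bound α hα
  refine ⟨C, hC, fun u X hu hX => ?_⟩
  have hX0 : 0 ≤ X := hu.trans hX
  rcases hu.eq_or_lt with rfl | hu
  · simp; positivity
  · rw [abs_mul, abs_of_pos hu]
    calc u * |GJ α u| ≤ u * (C * u ^ (α - 1/2)) := by gcongr; exact h u hu
      _ = C * u ^ (α + 1/2) := by
        rw [show α + 1/2 = (α - 1/2) + 1 by ring, Real.rpow_add_one hu.ne']; ring
      _ ≤ _ := by gcongr

theorem GJ_up_bound (α : ℝ) (hα : 0 < α) :
    ∃ C : ℝ, 0 < C ∧ ∀ u X : ℝ, 0 ≤ u → u ≤ X → |GJ (α+1) u| ≤ C * X ^ (α + 1/2) := by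
  obtain ⟨C, hC, h⟩ := GJ_bound (α+1) (by positivity)
  refine ⟨C, hC, fun u X hu hX => ?_⟩
  have hX0 : 0 ≤ X := hu.trans hX
  rcases hu.eq_or_lt with rfl | hu
  · have : GJ (α+1) 0 = 0 := by unfold GJ; rw [Real.zero_rpow (by positivity), zero_mul]
    rw [this, abs_zero]; positivity
  · refine (h u hu).trans ?_
    rw [show α + 1 - 1/2 = α + 1/2 by ring]
    gcongr

theorem GJ_cont (α : ℝ) (hα : 0 < α) : ContinuousOn (GJ α) (Set.Ici 0) := by
  refine ContinuousOn.mul ?_ (PJ_cont α hα)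
  exact (Real.continuous_rpow_const hα.le).continuousOn

theorem GJ_deriv_up (α : ℝ) (hα : 0 < α) (u : ℝ) (hu : 0 < u) :
    HasDerivAt (GJ (α+1)) (2 * π * (u * GJ α u)) u := by
  have h1 := Real.hasDerivAt_rpow_const (x := u) (p := α+1) (Or.inl hu.ne')
  refine (h1.mul (PJ_deriv_up α hα u hu)).congr_deriv ?_
  unfold GJ
  rw [add_sub_cancel_right, Real.rpow_add_one hu.ne']
  field_simp
  ring

theorem uGJ_deriv (α : ℝ) (hα : 0 < α) (u : ℝ) (hu : 0 < u) :
    HasDerivAt (fun u => u * GJ α u) ((1 + 2 * α) * GJ α u - 2 * π * GJ (α+1) u) u := by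
  have h1 := Real.hasDerivAt_rpow_const (x := u) (p := α) (Or.inl hu.ne')
  refine ((hasDerivAt_id u).mul (h1.mul (PJ_deriv_down α hα u hu))).congr_deriv ?_
  simp only [Pi.mul_apply, id]
  unfold GJ
  rw [Real.rpow_sub_one hu.ne', Real.rpow_add_one hu.ne']
  field_simp
  ring

theorem Jcal_eq (ν : ℝ) (k : ℕ) (X : ℝ) (hX : 0 ≤ X) :
    Jcal ν k X = ∫ u in (0:ℝ)..X, (X^2 - u^2) ^ (((k:ℝ) - 2)/2) * (u * GJ ν u) := by
  unfold Jcal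
  refine intervalIntegral.integral_congr_Ioo_of_le hX ?_
  intro u hu
  simp only [GJ, PJ]
  rw [Real.rpow_add_one hu.1.ne']; ring

theorem rpow_intble (X r : ℝ) (hX : 0 < X) (hr : -1 < r) :
    IntervalIntegrable (fun u : ℝ => (X^2 - u^2) ^ r) MeasureTheory.volume 0 X := by
  have h1 : IntervalIntegrable (fun u : ℝ => (X - u) ^ r) MeasureTheory.volume 0 X := by
    have := (intervalIntegral.intervalIntegrable_rpow' (a := X) (b := 0) hr).comp_sub_left X
    simpa using this
  have h2 : ContinuousOn (fun u : ℝ => (X + u)^r) (Set.uIcc 0 X) := by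
    intro u hu
    rw [Set.uIcc_of_le hX.le] at hu
    have : X + u ≠ 0 := by linarith [hu.1]
    exact (ContinuousAt.rpow_const (by fun_prop) (Or.inl this)).continuousWithinAt
  refine (h1.mul_continuousOn h2).congr ?_
  intro u hu
  rw [Set.uIoc_of_le hX.le] at hu
  simp only
  rw [← Real.mul_rpow (by linarith [hu.2]) (by linarith [hu.1])]
  congr 1; ring

theorem parts (ν : ℝ) (hν : 0 < ν) (X b s : ℝ) (hb : 0 ≤ b) (hbX : b ≤ X)
    (hc : ContinuousOn (fun u : ℝ => (X^2 - u^2)^s) (Set.Icc 0 b))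
    (hi : IntervalIntegrable (fun u : ℝ => (X^2 - u^2)^(s-1)) MeasureTheory.volume 0 b) :
    ∫ u in (0:ℝ)..b, (X^2 - u^2)^s * (u * GJ ν u) =
      (X^2 - b^2)^s * (GJ (ν+1) b / (2*π))
        - ∫ u in (0:ℝ)..b, (-(2*s)*((X^2-u^2)^(s-1)*u)) * (GJ (ν+1) u / (2*π)) := by
  have hp := Real.pi_pos
  have hG := GJ_cont ν hν
  have hG1 := GJ_cont (ν+1) (by positivity)
  have hsub : Set.Icc 0 b ⊆ Set.Ici (0:ℝ) := fun x hx => hx.1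
  have h0 : GJ (ν+1) 0 = 0 := by unfold GJ; rw [Real.zero_rpow (by positivity), zero_mul]
  have := intervalIntegral.integral_mul_deriv_eq_deriv_mul_of_hasDerivAt (a := 0) (b := b)
    (u := fun u : ℝ => (X^2 - u^2)^s) (v := fun u => GJ (ν+1) u / (2*π))
    (u' := fun u => -(2*s)*((X^2-u^2)^(s-1)*u)) (v' := fun u => u * GJ ν u) ?_ ?_ ?_ ?_ ?_ ?_
  · rw [this, h0]; ring
  · rwa [Set.uIcc_of_le hb]
  · rw [Set.uIcc_of_le hb]
    exact (hG1.mono hsub).div_const _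
  · intro u hu
    rw [min_eq_left hb, max_eq_right hb] at hu
    have hpos : X^2 - u^2 ≠ 0 := by
      have : 0 < (X-u)*(X+u) := mul_pos (by linarith [hu.2]) (by linarith [hu.1, hu.2])
      nlinarith
    have h1 : HasDerivAt (fun u : ℝ => X^2 - u^2) (-(2*u)) u := by
      simpa using (hasDerivAt_pow 2 u).const_sub (X^2)
    refine (h1.rpow_const (p := s) (Or.inl hpos)).congr_deriv ?_
    ring
  · intro u hu
    rw [min_eq_left hb, max_eq_right hb] at hu
    refine ((GJ_deriv_up ν hν u hu.1).div_const (2*π)).congr_deriv ?_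
    field_simp
  · exact (hi.mul_continuousOn continuousOn_id).const_mul _
  · refine ContinuousOn.intervalIntegrable ?_
    rw [Set.uIcc_of_le hb]
    exact continuousOn_id.mul (hG.mono hsub)

theorem cont_pow (X b s : ℝ) (hX : b < X) :
    ContinuousOn (fun u : ℝ => (X^2 - u^2)^s) (Set.Icc 0 b) := by
  intro u hu
  have hpos : X^2 - u^2 ≠ 0 := by
    have : 0 < (X-u)*(X+u) := mul_pos (by linarith [hu.2]) (by linarith [hu.1, hu.2])
    nlinarith
  have h1 : ContinuousAt (fun u : ℝ => X^2 - u^2) u := by fun_prop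
  exact (h1.rpow_const (p := s) (Or.inl hpos)).continuousWithinAt

theorem far_bound (ν : ℝ) (hν : 0 < ν) (s : ℝ) (hs : s ≤ 0) :
    ∃ C : ℝ, ∀ X : ℝ, 1 ≤ X →
      |∫ u in (0:ℝ)..(X-1), (X^2 - u^2)^s * (u * GJ ν u)| ≤ C * X ^ (ν + 1/2 + s) := by
  obtain ⟨C, hC, hG⟩ := GJ_up_bound ν hν
  have hp := Real.pi_pos
  refine ⟨C / π, fun X hX => ?_⟩
  have hb : 0 ≤ X - 1 := by linarith
  have hX0 : 0 < X := by linarith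
  have hc := cont_pow X (X-1) s (by linarith)
  have hc' := cont_pow X (X-1) (s-1) (by linarith)
  have hi : IntervalIntegrable (fun u : ℝ => (X^2 - u^2)^(s-1)) MeasureTheory.volume 0 (X-1) := by
    refine ContinuousOn.intervalIntegrable ?_
    rwa [Set.uIcc_of_le hb]
  have hi' : IntervalIntegrable (fun u => -(2*s)*((X^2-u^2)^(s-1)*u)) MeasureTheory.volume 0 (X-1) :=
    (hi.mul_continuousOn continuousOn_id).const_mul _
  rw [parts ν hν X (X-1) s hb (by linarith) hc hi]
  have hend : (X^2 - (X-1)^2)^s ≤ X^s :=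
    Real.rpow_le_rpow_of_nonpos hX0 (by nlinarith) hs
  have hend0 : 0 ≤ (X^2 - (X-1)^2)^s := Real.rpow_nonneg (by nlinarith) _
  have hftc : ∫ u in (0:ℝ)..(X-1), (-(2*s)*((X^2-u^2)^(s-1)*u)) = (X^2 - (X-1)^2)^s - (X^2 - 0^2)^s := by
    refine intervalIntegral.integral_eq_sub_of_hasDerivAt_of_le (f := fun u : ℝ => (X^2 - u^2)^s) hb hc ?_ hi'
    intro u hu
    have hpos : X^2 - u^2 ≠ 0 := by
      have : 0 < (X-u)*(X+u) := mul_pos (by linarith [hu.2]) (by linarith [hu.1, hu.2])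
      nlinarith
    have h1 : HasDerivAt (fun u : ℝ => X^2 - u^2) (-(2*u)) u := by
      simpa using (hasDerivAt_pow 2 u).const_sub (X^2)
    refine (h1.rpow_const (p := s) (Or.inl hpos)).congr_deriv ?_
    ring
  have h1 : |(X^2 - (X-1)^2)^s * (GJ (ν+1) (X-1) / (2*π))| ≤ X^s * (C * X^(ν+1/2) / (2*π)) := by
    rw [abs_mul, abs_of_nonneg hend0, abs_div, abs_of_pos (show 0 < 2*π by positivity)]
    gcongr
    exact hG _ _ hb (by linarith)
  have h2 : |∫ u in (0:ℝ)..(X-1), (-(2*s)*((X^2-u^2)^(s-1)*u)) * (GJ (ν+1) u / (2*π))|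
      ≤ ∫ u in (0:ℝ)..(X-1), (-(2*s)*((X^2-u^2)^(s-1)*u)) * (C * X^(ν+1/2) / (2*π)) := by
    rw [← Real.norm_eq_abs]
    refine intervalIntegral.norm_integral_le_of_norm_le hb ?_ (hi'.mul_const _)
    refine Eventually.of_forall fun u hu => ?_
    have h3 : 0 ≤ X^2 - u^2 := by nlinarith [hu.1, hu.2]
    have h4 : 0 ≤ -(2*s)*((X^2-u^2)^(s-1)*u) :=
      mul_nonneg (by linarith) (mul_nonneg (Real.rpow_nonneg h3 _) hu.1.le)
    rw [norm_mul, Real.norm_of_nonneg h4, norm_div, Real.norm_of_nonneg (show 0 ≤ 2*π by positivity)]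
    gcongr
    exact hG _ _ hu.1.le (by linarith [hu.2])
  rw [intervalIntegral.integral_mul_const, hftc] at h2
  have h5 : ((X^2 - (X-1)^2)^s - (X^2 - 0^2)^s) * (C * X^(ν+1/2) / (2*π)) ≤ X^s * (C * X^(ν+1/2) / (2*π)) := by
    gcongr
    have : 0 ≤ (X^2-0^2)^s := Real.rpow_nonneg (by nlinarith) _
    linarith
  refine (abs_sub _ _).trans ((add_le_add h1 (h2.trans h5)).trans (le_of_eq ?_))
  rw [Real.rpow_add hX0 (ν+1/2) s]
  field_simp
  ring

theorem step (ν : ℝ) (hν : 0 < ν) (k : ℕ) (X : ℝ) (hX : 0 < X) :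
    Jcal ν (k+3) X = (((k:ℝ)+1)/2/π) * Jcal (ν+1) (k+1) X := by
  have hp := Real.pi_pos
  have hk : (0:ℝ) ≤ k := by positivity
  rw [Jcal_eq _ _ _ hX.le, Jcal_eq _ _ _ hX.le]
  have hs : (((k+3:ℕ):ℝ) - 2)/2 = ((k:ℝ)+1)/2 := by push_cast; ring
  have hs' : (((k+1:ℕ):ℝ) - 2)/2 = ((k:ℝ)+1)/2 - 1 := by push_cast; ring
  rw [hs, hs', parts ν hν X X _ hX.le le_rfl ?_ (rpow_intble X _ hX (by linarith)),
    sub_self, Real.zero_rpow (by positivity), zero_mul, zero_sub, ← intervalIntegral.integral_neg,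
    ← intervalIntegral.integral_const_mul]
  · congr 1; ext u; field_simp
  · refine Continuous.continuousOn ?_
    exact Continuous.rpow_const (by fun_prop) (fun _ => Or.inr (by positivity))

theorem base2 (ν : ℝ) (hν : 0 < ν) :
    ∃ C : ℝ, ∀ X : ℝ, 2 ≤ X → |Jcal ν 2 X| ≤ C * X ^ (ν + 1/2) := by
  obtain ⟨C, hC, hG⟩ := GJ_up_bound ν hν
  have hp := Real.pi_pos
  refine ⟨C / (2*π), fun X hX => ?_⟩
  have hX0 : 0 < X := by linarith
  have hsub : Set.Icc 0 X ⊆ Set.Ici (0:ℝ) := fun x hx => hx.1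
  have h0 : GJ (ν+1) 0 = 0 := by unfold GJ; rw [Real.zero_rpow (by positivity), zero_mul]
  have := intervalIntegral.integral_eq_sub_of_hasDerivAt_of_le (a := 0) (b := X)
    (f := fun u => GJ (ν+1) u / (2*π)) (f' := fun u => u * GJ ν u) hX0.le
    (((GJ_cont (ν+1) (by positivity)).mono hsub).div_const _) (fun u hu => by
      refine ((GJ_deriv_up ν hν u hu.1).div_const (2*π)).congr_deriv ?_
      field_simp) (by
      refine ContinuousOn.intervalIntegrable ?_
      rw [Set.uIcc_of_le hX0.le]
      exact continuousOn_id.mul ((GJ_cont ν hν).mono hsub))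
  rw [Jcal_eq _ _ _ hX0.le]
  simp only [Nat.cast_ofNat, sub_self, zero_div, Real.rpow_zero, one_mul]
  rw [this, h0, zero_div, sub_zero, abs_div, abs_of_pos (show 0 < 2*π by positivity), div_mul_eq_mul_div]
  gcongr
  exact hG X X hX0.le le_rfl

theorem base1 (ν : ℝ) (hν : 0 < ν) :
    ∃ C : ℝ, ∀ X : ℝ, 2 ≤ X → |Jcal ν 1 X| ≤ C * X ^ ν := by
  obtain ⟨C, hC⟩ := far_bound ν hν (-(1/2)) (by norm_num)
  obtain ⟨D, hD, hG⟩ := GJ_bound' ν hν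
  refine ⟨C + 2 * D, fun X hX => ?_⟩
  have hX0 : 0 < X := by linarith
  have hX1 : 0 ≤ X - 1 := by linarith
  have hsub : Set.Icc 0 X ⊆ Set.Ici (0:ℝ) := fun x hx => hx.1
  rw [Jcal_eq _ _ _ hX0.le, show ((1:ℕ):ℝ) - 2 = -1 by norm_num, show (-1:ℝ)/2 = -(1/2) by norm_num]
  have hi : IntervalIntegrable (fun u : ℝ => (X^2 - u^2)^(-(1/2:ℝ)) * (u * GJ ν u)) MeasureTheory.volume 0 X := by
    refine (rpow_intble X _ hX0 (by norm_num)).mul_continuousOn ?_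
    rw [Set.uIcc_of_le hX0.le]
    exact continuousOn_id.mul ((GJ_cont ν hν).mono hsub)
  rw [← intervalIntegral.integral_add_adjacent_intervals (b := X-1)
    (hi.mono_set (by rw [Set.uIcc_of_le hX0.le, Set.uIcc_of_le hX1]; exact Set.Icc_subset_Icc le_rfl (by linarith)))
    (hi.mono_set (by rw [Set.uIcc_of_le hX0.le, Set.uIcc_of_le (by linarith)]; exact Set.Icc_subset_Icc hX1 le_rfl))]
  have h1 := hC X (by linarith)
  rw [show ν + 1/2 + -(1/2) = ν by ring] at h1
  refine (abs_add_le _ _).trans ?_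
  rw [add_mul]
  refine add_le_add h1 ?_
  have hintg : IntervalIntegrable (fun u : ℝ => (X - u) ^ (-(1/2:ℝ))) MeasureTheory.volume (X-1) X := by
    have := (intervalIntegral.intervalIntegrable_rpow' (a := 1) (b := 0) (r := -(1/2:ℝ)) (by norm_num)).comp_sub_left X
    simpa using this
  have h2 : |∫ u in (X-1)..X, (X^2 - u^2)^(-(1/2:ℝ)) * (u * GJ ν u)| ≤
      ∫ u in (X-1)..X, (D * X^ν) * (X - u)^(-(1/2:ℝ)) := by
    rw [← Real.norm_eq_abs]
    refine intervalIntegral.norm_integral_le_of_norm_le (by linarith) ?_ (hintg.const_mul _)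
    refine Eventually.of_forall fun u hu => ?_
    have hu0 : 0 < u := by linarith [hu.1]
    have hu1 : 0 ≤ X - u := by linarith [hu.2]
    rw [norm_mul, show X^2 - u^2 = (X + u) * (X - u) by ring, Real.mul_rpow (by linarith) hu1,
      Real.norm_of_nonneg (by positivity)]
    calc _ ≤ X^(-(1/2:ℝ)) * (X-u)^(-(1/2:ℝ)) * (D * X^(ν+1/2)) := by
          gcongr ?_ * _ * ?_
          · exact Real.rpow_le_rpow_of_nonpos hX0 (by linarith) (by norm_num)
          · exact hG u X hu0.le hu.2
      _ = _ := by
        rw [Real.rpow_add hX0, Real.rpow_neg hX0.le]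
        have : X^(1/2:ℝ) ≠ 0 := by positivity
        field_simp
  refine h2.trans (le_of_eq ?_)
  rw [intervalIntegral.integral_const_mul, intervalIntegral.integral_comp_sub_left (fun x => x^(-(1/2:ℝ))),
    integral_rpow (Or.inl (by norm_num))]
  norm_num
  ring

theorem base0 (ν : ℝ) (hν : 0 < ν) :
    ∃ C : ℝ, ∀ X : ℝ, 2 ≤ X → |Jcal ν 0 X| ≤ C * X ^ (ν - 1/2) := by
  obtain ⟨C, hC⟩ := far_bound ν hν (-1) (by norm_num)
  obtain ⟨D, hD, hG⟩ := GJ_bound' ν hν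
  obtain ⟨E, hE, hG1⟩ := GJ_up_bound ν hν
  have hp := Real.pi_pos
  refine ⟨max 0 (C + ((1+2*ν)*D+2*π*E)), fun X hX => ?_⟩
  have hX0 : 0 < X := by linarith
  have hX1 : 0 ≤ X - 1 := by linarith
  rw [Jcal_eq _ _ _ hX0.le, show (((0:ℕ):ℝ) - 2)/2 = -1 by norm_num]
  by_cases hi : IntervalIntegrable (fun u : ℝ => (X^2 - u^2)^(-1:ℝ) * (u * GJ ν u)) MeasureTheory.volume 0 X
  swap
  · rw [intervalIntegral.integral_undef hi, abs_zero]; positivity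
  refine le_trans ?_ (mul_le_mul_of_nonneg_right (le_max_right _ _) (by positivity))
  have hz : X * GJ ν X = 0 := by
    by_contra hne
    refine not_intervalIntegrable_of_sub_inv_isBigO_punctured (c := X) ?_ hX0.ne (Set.right_mem_uIcc) hi
    have hH : ContinuousAt (fun u => u * GJ ν u) X := (uGJ_deriv ν hν X hX0).continuousAt
    have hev : ∀ᶠ u in nhds X, |X * GJ ν X| / 2 < |u * GJ ν u| := by
      refine hH.abs.eventually (lt_mem_nhds ?_)
      have : 0 < |X * GJ ν X| := abs_pos.2 hne
      linarith
    have hev2 : ∀ᶠ u in nhds X, u < X + 1 := gt_mem_nhds (by linarith)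
    have hev3 : ∀ᶠ u in nhds X, 0 < u := lt_mem_nhds hX0
    have ha : 0 < |X * GJ ν X| := abs_pos.2 hne
    refine IsBigO.of_bound ((2*X+1) * (2/|X * GJ ν X|)) ?_
    filter_upwards [nhdsWithin_le_nhds hev, nhdsWithin_le_nhds hev2, nhdsWithin_le_nhds hev3,
      self_mem_nhdsWithin] with u h1 h2 h3 h4
    have h5 : u - X ≠ 0 := sub_ne_zero.2 h4
    have h6 : (X^2-u^2)^(-1:ℝ) = -((u-X)⁻¹ * (X+u)⁻¹) := by
      rw [Real.rpow_neg_one, show X^2 - u^2 = -((u-X)*(X+u)) by ring, inv_neg, mul_inv]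
    rw [h6, norm_mul, norm_neg, norm_mul, Real.norm_of_nonneg (show 0 ≤ (X+u)⁻¹ by positivity),
      Real.norm_eq_abs (u * GJ ν u)]
    have h8 : X + u ≤ 2*X+1 := by linarith
    have h7 : 1 ≤ (2*X+1) * (2/|X * GJ ν X|) * ((X+u)⁻¹ * |u * GJ ν u|) := by
      calc (1:ℝ) = (X+u) * (2/|X * GJ ν X|) * ((X+u)⁻¹ * (|X * GJ ν X|/2)) := by
            have : X + u ≠ 0 := by positivity
            field_simp
        _ ≤ _ := by
          gcongr ?_ * _ * (_ * ?_)
    calc ‖(u-X)⁻¹‖ = ‖(u-X)⁻¹‖ * 1 := by ring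
      _ ≤ ‖(u-X)⁻¹‖ * ((2*X+1) * (2/|X * GJ ν X|) * ((X+u)⁻¹ * |u * GJ ν u|)) := by gcongr
      _ = _ := by ring
  rw [← intervalIntegral.integral_add_adjacent_intervals (b := X-1)
    (hi.mono_set (by rw [Set.uIcc_of_le hX0.le, Set.uIcc_of_le hX1]; exact Set.Icc_subset_Icc le_rfl (by linarith)))
    (hi.mono_set (by rw [Set.uIcc_of_le hX0.le, Set.uIcc_of_le (by linarith)]; exact Set.Icc_subset_Icc hX1 le_rfl))]
  have h1 := hC X (by linarith)
  rw [show ν + 1/2 + -1 = ν - 1/2 by ring] at h1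
  refine (abs_add_le _ _).trans ?_
  rw [add_mul]
  refine add_le_add h1 ?_
  set K := (1+2*ν)*D+2*π*E
  have hlip : ∀ u ∈ Set.Icc (X-1) X, |u * GJ ν u| ≤ K * X^(ν+1/2) * (X-u) := by
    intro u hu
    have := Convex.norm_image_sub_le_of_norm_hasDerivWithin_le (𝕜 := ℝ) (s := Set.Icc (X-1) X)
      (f := fun u => u * GJ ν u) (f' := fun u => (1 + 2 * ν) * GJ ν u - 2 * π * GJ (ν+1) u)
      (C := K * X^(ν+1/2)) (x := X) (y := u)
      (fun v hv => (uGJ_deriv ν hν v (by linarith [hv.1])).hasDerivWithinAt) ?_ (convex_Icc _ _)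
      ⟨by linarith, le_rfl⟩ hu
    · simp only [hz, sub_zero] at this
      rwa [Real.norm_eq_abs, Real.norm_eq_abs, abs_sub_comm,
        abs_of_nonneg (sub_nonneg.2 hu.2)] at this
    · intro v hv
      have hv1 : 1 ≤ v := by linarith [hv.1]
      have e1 := hG v X (by linarith) hv.2
      have e2 := hG1 v X (by linarith) hv.2
      have e3 : |GJ ν v| ≤ |v * GJ ν v| := by
        rw [abs_mul]; exact le_mul_of_one_le_left (abs_nonneg _) (hv1.trans (le_abs_self _))
      refine (norm_sub_le _ _).trans ?_
      rw [norm_mul, norm_mul, Real.norm_of_nonneg (show 0 ≤ 1+2*ν by positivity),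
        Real.norm_of_nonneg (show 0 ≤ 2*π by positivity), Real.norm_eq_abs, Real.norm_eq_abs]
      calc _ ≤ (1+2*ν) * (D * X^(ν+1/2)) + 2*π*(E * X^(ν+1/2)) := by
            gcongr
            exact e3.trans e1
        _ = _ := by ring
  have hK : 0 ≤ K := by positivity
  have h2 := intervalIntegral.norm_integral_le_of_norm_le_const (a := X-1) (b := X)
    (f := fun u : ℝ => (X^2 - u^2)^(-1:ℝ) * (u * GJ ν u)) (C := K * X^(ν-1/2)) ?_
  · simpa using h2
  · intro u hu
    rw [Set.uIoc_of_le (by linarith)] at hu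
    rcases hu.2.eq_or_lt with rfl | hlt
    · rw [hz]; simp; positivity
    have hl := hlip u ⟨hu.1.le, hu.2⟩
    have hd : 0 < X - u := by linarith
    have hs : 0 < X + u := by linarith [hu.1]
    rw [norm_mul, Real.rpow_neg_one, show X^2 - u^2 = (X+u)*(X-u) by ring,
      Real.norm_of_nonneg (by positivity), Real.norm_eq_abs]
    calc _ ≤ ((X+u)*(X-u))⁻¹ * (K * X^(ν+1/2) * (X-u)) := by gcongr
      _ = K * X^(ν+1/2) * (X+u)⁻¹ := by field_simp
      _ ≤ K * X^(ν+1/2) * X⁻¹ := by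
        gcongr
        linarith [hu.1]
      _ = _ := by
        rw [mul_assoc, ← div_eq_mul_inv, ← Real.rpow_sub_one hX0.ne']
        congr 2; ring

theorem all_k (k : ℕ) : ∀ ν : ℝ, 0 < ν →
    ∃ C : ℝ, ∀ X : ℝ, 2 ≤ X → |Jcal ν k X| ≤ C * X ^ (((k:ℝ) + 2*ν - 1)/2) := by
  induction k using Nat.strong_induction_on with
  | _ k ih =>
    intro ν hν
    match k, ih with
    | 0, _ =>
      obtain ⟨C, h⟩ := base0 ν hν
      refine ⟨C, fun X hX => ?_⟩
      convert h X hX using 3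
      push_cast; ring
    | 1, _ =>
      obtain ⟨C, h⟩ := base1 ν hν
      refine ⟨C, fun X hX => ?_⟩
      convert h X hX using 3
      push_cast; ring
    | 2, _ =>
      obtain ⟨C, h⟩ := base2 ν hν
      refine ⟨C, fun X hX => ?_⟩
      convert h X hX using 3
      push_cast; ring
    | k+3, ih =>
      obtain ⟨C, h⟩ := ih (k+1) (by omega) (ν+1) (by positivity)
      have hp := Real.pi_pos
      refine ⟨(((k:ℝ)+1)/2/π) * C, fun X hX => ?_⟩
      rw [step ν hν k X (by linarith), abs_mul, abs_of_nonneg (by positivity), mul_assoc]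
      have e : (((k+3:ℕ):ℝ) + 2*ν - 1)/2 = (((k+1:ℕ):ℝ) + 2*(ν+1) - 1)/2 := by push_cast; ring
      rw [e]
      gcongr
      exact h X hX

theorem Jcal_bound (ν : ℝ) (hν : 0 < ν) (k : ℕ) :
    (fun X : ℝ => Jcal ν k X) =O[atTop] fun X : ℝ => X ^ (((k:ℝ) + 2*ν - 1)/2) := by
  obtain ⟨C, h⟩ := all_k k ν hν
  refine IsBigO.of_bound C ?_
  filter_upwards [eventually_ge_atTop 2] with X hX
  have hX0 : 0 ≤ X := by linarith
  rw [Real.norm_eq_abs, Real.norm_of_nonneg (by positivity)]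
  exact h X hX
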